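/- arXiv:1511.05769 — 3 statements merged into one kernel-verified Lean document; each statement's English description precedes it below -/
import Mathlib

section
/- Let A₁, A₂, ..., A_l be a commuting family of matrices in M_{n×n}(ℂ) (each pair commutes), and let 𝓕 be the unital ℂ-subalgebra of M_{n×n}(ℂ) generated by A₁, ..., A_l (and the identity matrix). Then dim_ℂ 𝓕 ≤ (l+1)·n^{2 − 2/(l+1)}. -/
open Polynomial

theorem Submodule.finrank_finset_prod_le {K R ι : Type*} [Field K] [CommRing R] [Algebra K R]
    [FiniteDimensional K R] (s : Finset ι) (B : ι → Submodule K R) :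
    Module.finrank K ↥(∏ i ∈ s, B i) ≤ ∏ i ∈ s, Module.finrank K (B i) := by
  classical
  induction s using Finset.induction_on with
  | empty =>
    have h : ∀ P : Submodule K R, P = K ∙ (1 : R) → Module.finrank K P ≤ 1 := by
      rintro P rfl
      exact (finrank_span_le_card _).trans (by simp)
    simpa using h _ (Finset.prod_empty.trans Submodule.one_eq_span)
  | insert a s ha ih =>
    rw [Finset.prod_insert ha, Finset.prod_insert ha]
    refine le_trans ?_ (Nat.mul_le_mul_left _ ih)
    rw [← Module.finrank_tensorProduct, ← Submodule.mulMap_range]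
    exact LinearMap.finrank_range_le _

theorem Submodule.prod_mem_finset_prod {K R ι : Type*} [CommSemiring K] [CommSemiring R]
    [Algebra K R] (s : Finset ι) (B : ι → Submodule K R) (x : ι → R) (hx : ∀ i ∈ s, x i ∈ B i) :
    ∏ i ∈ s, x i ∈ ∏ i ∈ s, B i := by
  classical
  induction s using Finset.induction_on with
  | empty => simpa using Submodule.one_le.1 (le_refl (1 : Submodule K R))
  | insert i s hi ih =>
    rw [Finset.prod_insert hi, Finset.prod_insert hi]
    exact Submodule.mul_mem_mul (hx i (s.mem_insert_self i))
      (ih fun j hj => hx j (Finset.mem_insert_of_mem hj))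

/-- A finite-dimensional `K[X]`-module has a nonzero annihilator generator `g`, and an element `x`
whose cyclic submodule has dimension `deg g`. -/
theorem Module.exists_annihilator_generator_smul_eq_zero_iff {K M : Type*} [Field K]
    [AddCommGroup M] [Module K M] [Module K[X] M] [IsScalarTower K K[X] M]
    [FiniteDimensional K M] :
    ∃ (g : K[X]) (x : M), g ≠ 0 ∧ (∀ f : K[X], (∀ u : M, f • u = 0) → g ∣ f) ∧
      (∀ u : M, g • u = 0) ∧ Module.finrank K ↥((K[X] ∙ x).restrictScalars K) = g.natDegree := by
  have : Module.Finite K[X] M := Module.Finite.of_restrictScalars_finite K K[X] M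
  obtain ⟨x, hx⟩ := Module.exists_ker_toSpanSingleton_eq_annihilator K[X] M
  obtain ⟨g, hg⟩ := IsPrincipalIdealRing.principal (Module.annihilator K[X] M)
  have hgx : LinearMap.ker (LinearMap.toSpanSingleton K[X] M x) = Ideal.span {g} := hx.trans hg
  refine ⟨g, x, ?_, ?_, ?_, ?_⟩
  · rintro rfl
    have hinj : Function.Injective ((LinearMap.toSpanSingleton K[X] M x).restrictScalars K) := by
      rw [LinearMap.coe_restrictScalars, ← LinearMap.ker_eq_bot, hgx]; simp
    exact Polynomial.not_finite (R := K) (Module.Finite.of_injective _ hinj)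
  · intro f hf
    rw [← Ideal.mem_span_singleton, Ideal.span, ← hg]
    exact Module.mem_annihilator.2 hf
  · rw [← Module.mem_annihilator, hg]
    exact Ideal.mem_span_singleton_self g
  · rw [← finrank_quotient_span_eq_natDegree, ← hgx]
    have e := (LinearMap.toSpanSingleton K[X] M x).quotKerEquivRange.restrictScalars K
    rw [e.finrank_eq, LinearMap.range_toSpanSingleton]
    rfl

/-- There is a nonzero `p` of degree at most `dim M / (m + 1)` such that `p • M` lies in a submodule
generated by `m` elements. -/
theorem Module.exists_natDegree_mul_le_finrank_forall_smul_mem_span {K : Type*} [Field K] (m : ℕ) :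
    ∀ (M : Type*) [AddCommGroup M] [Module K M] [Module K[X] M] [IsScalarTower K K[X] M]
      [FiniteDimensional K M],
      ∃ (p : K[X]) (v : Fin m → M), p ≠ 0 ∧ p.natDegree * (m + 1) ≤ Module.finrank K M ∧
        (∀ f : K[X], (∀ u : M, f • u = 0) → p ∣ f) ∧
        ∀ u : M, p • u ∈ Submodule.span K[X] (Set.range v) := by
  induction m with
  | zero =>
    intro M _ _ _ _ _
    obtain ⟨g, x, h0, hd, hz, hr⟩ :=
      Module.exists_annihilator_generator_smul_eq_zero_iff (K := K) (M := M)
    refine ⟨g, Fin.elim0, h0, ?_, hd, fun u => by simp [hz]⟩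
    rw [← hr]
    simpa using Submodule.finrank_le _
  | succ m ih =>
    intro M _ _ _ _ _
    obtain ⟨g, x, h0, hd, hz, hr⟩ :=
      Module.exists_annihilator_generator_smul_eq_zero_iff (K := K) (M := M)
    obtain ⟨p, v, hp0, hp, hpd, hpv⟩ := ih (M ⧸ (K[X] ∙ x))
    have hpg : p ∣ g := hpd g fun u => by
      obtain ⟨u, rfl⟩ := Submodule.mkQ_surjective _ u
      rw [← map_smul, hz, map_zero]
    choose w hw using fun i => Submodule.mkQ_surjective _ (v i)
    refine ⟨p, Fin.cons x w, hp0, ?_, fun f hf => hpg.trans (hd f hf), fun u => ?_⟩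
    · have hdeg := natDegree_le_of_dvd hpg h0
      have h1 : Module.finrank K (M ⧸ (K[X] ∙ x)) + g.natDegree = Module.finrank K M := by
        rw [← hr]
        exact Submodule.finrank_quotient_add_finrank ((K[X] ∙ x).restrictScalars K)
      nlinarith
    · have h := hpv (Submodule.mkQ _ u)
      have hv : Set.range v = (Submodule.mkQ (K[X] ∙ x)) '' Set.range w := by
        rw [← Set.range_comp]; congr 1; ext i; exact (hw i).symm
      rw [← map_smul, hv, ← Submodule.map_span, ← Submodule.mem_comap, Submodule.comap_map_mkQ] at h
      rwa [Fin.range_cons, Submodule.span_insert]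

theorem Algebra.finrank_le_prod_natDegree {K R ι : Type*} [Field K] [CommRing R] [Algebra K R]
    [FiniteDimensional K R] [Fintype ι] (a : ι → R) (ha : Algebra.adjoin K (Set.range a) = ⊤)
    (p : ι → K[X]) (hp : ∀ i, p i ≠ 0) (hpa : ∀ i, aeval (a i) (p i) = 0) :
    Module.finrank K R ≤ ∏ i, (p i).natDegree := by
  have hfin : ∀ i, Module.finrank K (aeval (R := K) (a i)).toLinearMap.range ≤ (p i).natDegree := by
    intro i
    have : Module.Finite K (K[X] ⧸ Ideal.span {p i}) := (AdjoinRoot.powerBasis (hp i)).finite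
    let f := Ideal.Quotient.liftₐ (Ideal.span {p i}) (aeval (R := K) (a i)) fun q hq => by
      obtain ⟨r, rfl⟩ := Ideal.mem_span_singleton.1 hq
      rw [map_mul, hpa, zero_mul]
    rw [← finrank_quotient_span_eq_natDegree]
    refine le_trans (Submodule.finrank_mono ?_) (LinearMap.finrank_range_le f.toLinearMap)
    rintro _ ⟨q, rfl⟩
    exact ⟨Ideal.Quotient.mk _ q, rfl⟩
  have htop : ∏ i, (aeval (R := K) (a i)).toLinearMap.range = ⊤ := by
    refine _root_.eq_top_iff.2 fun r _ => ?_
    rw [Algebra.adjoin_range_eq_range_aeval] at ha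
    obtain ⟨q, rfl⟩ := AlgHom.range_eq_top _ |>.1 ha r
    induction q using MvPolynomial.induction_on' with
    | monomial e c =>
      rw [MvPolynomial.aeval_monomial, ← Algebra.smul_def]
      refine Submodule.smul_mem _ _ ?_
      rw [Finsupp.prod_fintype _ _ (by simp)]
      exact Submodule.prod_mem_finset_prod _ _ _ fun i _ => ⟨X ^ e i, by simp⟩
    | add f g hf hg => rw [map_add]; exact add_mem (hf trivial) (hg trivial)
  rw [← finrank_top, ← htop]
  exact (Submodule.finrank_finset_prod_le _ _).trans (Finset.prod_le_prod' fun i _ => hfin i)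

/-- For `a` in a commutative algebra acting faithfully on `V`, some polynomial `p` in `a` of degree
at most `dim V / (m + 1)` generates an ideal of dimension at most `m * dim V`. -/
theorem Algebra.exists_natDegree_mul_le_finrank_span_aeval_le {K R V : Type*} [Field K] [CommRing R]
    [Algebra K R] [AddCommGroup V] [Module K V] [FiniteDimensional K V]
    (φ : R →ₐ[K] Module.End K V) (hφ : Function.Injective φ) (a : R) (m : ℕ) :
    ∃ p : K[X], p ≠ 0 ∧ p.natDegree * (m + 1) ≤ Module.finrank K V ∧
      Module.finrank K ((Ideal.span {aeval a p}).restrictScalars K) ≤ m * Module.finrank K V := by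
  obtain ⟨p, v, hp0, hp, -, hv⟩ :=
    Module.exists_natDegree_mul_le_finrank_forall_smul_mem_span (K := K) m
      (Module.AEval' (φ a))
  have hfr : Module.finrank K (Module.AEval' (φ a)) = Module.finrank K V :=
    (Module.AEval'.of (φ a)).symm.finrank_eq
  refine ⟨p, hp0, hfr ▸ hp, ?_⟩
  have : FiniteDimensional K R := Module.Finite.of_injective φ.toLinearMap hφ
  let E : R →ₗ[K] Fin m → V :=
    LinearMap.pi fun i =>
      (LinearMap.applyₗ ((Module.AEval'.of (φ a)).symm (v i))).comp φ.toLinearMap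
  let F : R →ₗ[K] R := LinearMap.mulLeft K (aeval a p)
  have hker : E.ker ≤ F.ker := by
    intro r hr
    have hr' : ∀ i, φ r ((Module.AEval'.of (φ a)).symm (v i)) = 0 := fun i => congrFun hr i
    let T : Module.AEval' (φ a) →ₗ[K[X]] Module.AEval' (φ a) :=
      LinearMap.ofAEval _ ((Module.AEval'.of (φ a)).toLinearMap.comp (φ r)) (by
        intro u
        simp only [LinearMap.comp_apply, LinearEquiv.coe_coe, Module.AEval'.X_smul_of,
          Module.End.smul_def]
        rw [← Module.End.mul_apply, ← Module.End.mul_apply, ← map_mul, ← map_mul, mul_comm])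
    have hT : ∀ u, T u = Module.AEval'.of (φ a) (φ r ((Module.AEval'.of (φ a)).symm u)) :=
      fun u => rfl
    have hle : Submodule.span K[X] (Set.range v) ≤ T.ker := by
      rw [Submodule.span_le]
      rintro _ ⟨i, rfl⟩
      simp [hT, hr']
    rw [LinearMap.mem_ker]
    change aeval a p * r = 0
    apply hφ
    rw [mul_comm, map_mul, map_zero]
    ext u
    have h := hle (hv (Module.AEval'.of (φ a) u))
    rw [LinearMap.mem_ker, hT, LinearEquiv.map_eq_zero_iff] at h
    rw [← Polynomial.aeval_algHom_apply]
    exact h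
  have h1 : (Ideal.span {aeval a p}).restrictScalars K = F.range := by
    ext r
    simp only [Submodule.restrictScalars_mem, Ideal.mem_span_singleton, LinearMap.mem_range]
    exact ⟨fun ⟨c, hc⟩ => ⟨c, hc.symm⟩, fun ⟨c, hc⟩ => ⟨c, hc.symm⟩⟩
  have h2 := Submodule.finrank_mono hker
  have h3 := E.finrank_range_add_finrank_ker
  have h4 := F.finrank_range_add_finrank_ker
  have h5 : Module.finrank K E.range ≤ m * Module.finrank K V := by
    exact (Submodule.finrank_le _).trans (Module.finrank_pi_fintype K).le |>.trans (by simp)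
  rw [h1]
  omega

theorem Ideal.finrank_span_range_le {K R ι : Type*} [Field K] [CommRing R] [Algebra K R]
    [FiniteDimensional K R] [Fintype ι] (c : ι → R) :
    Module.finrank K ((Ideal.span (Set.range c)).restrictScalars K) ≤
      ∑ i, Module.finrank K ((Ideal.span {c i}).restrictScalars K) := by
  classical
  suffices h : ∀ s : Finset ι, Module.finrank K
      ↥(s.sup fun i => (Ideal.span {c i}).restrictScalars K) ≤
      ∑ i ∈ s, Module.finrank K ((Ideal.span {c i}).restrictScalars K) by
    refine le_trans (Submodule.finrank_mono ?_) (h Finset.univ)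
    intro r hr
    obtain ⟨d, rfl⟩ := (Ideal.mem_span_range_iff_exists_fun).1 hr
    refine Submodule.sum_mem _ fun i _ => ?_
    exact Finset.le_sup (f := fun i => (Ideal.span {c i}).restrictScalars K) (Finset.mem_univ i)
      (Ideal.mul_mem_left _ _ (Ideal.mem_span_singleton_self _))
  intro s
  induction s using Finset.induction_on with
  | empty => rw [Finset.sup_empty]; simp
  | insert i s hi ih =>
    rw [Finset.sup_insert, Finset.sum_insert hi]
    exact (Submodule.finrank_add_le_finrank_add_finrank _ _).trans (Nat.add_le_add_left ih _)

theorem Algebra.exists_finrank_le_prod_add {K R V ι : Type*} [Field K] [CommRing R]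
    [Algebra K R] [AddCommGroup V] [Module K V] [FiniteDimensional K V] [Fintype ι]
    (φ : R →ₐ[K] Module.End K V) (hφ : Function.Injective φ) (a : ι → R)
    (ha : Algebra.adjoin K (Set.range a) = ⊤) (m : ℕ) :
    ∃ d : ι → ℕ, (∀ i, d i * (m + 1) ≤ Module.finrank K V) ∧
      Module.finrank K R ≤ ∏ i, d i + Fintype.card ι * (m * Module.finrank K V) := by
  have : FiniteDimensional K R := Module.Finite.of_injective φ.toLinearMap hφ
  choose p hp0 hpd hpf using fun i =>
    Algebra.exists_natDegree_mul_le_finrank_span_aeval_le φ hφ (a i) m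
  refine ⟨fun i => (p i).natDegree, hpd, ?_⟩
  let J : Ideal R := Ideal.span (Set.range fun i => aeval (a i) (p i))
  have hJ : Module.finrank K (J.restrictScalars K) ≤
      Fintype.card ι * (m * Module.finrank K V) := by
    refine (Ideal.finrank_span_range_le _).trans ?_
    exact (Finset.sum_le_card_nsmul _ _ _ fun i _ => hpf i).trans (by simp)
  have hadj : Algebra.adjoin K (Set.range fun i => Ideal.Quotient.mkₐ K J (a i)) = ⊤ := by
    have h := congrArg (Subalgebra.map (Ideal.Quotient.mkₐ K J)) ha
    rwa [AlgHom.map_adjoin, ← Set.range_comp, Algebra.map_top,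
      (AlgHom.range_eq_top _).2 (Ideal.Quotient.mkₐ_surjective K J)] at h
  have hQ : Module.finrank K (R ⧸ J) ≤ ∏ i, (p i).natDegree := by
    refine Algebra.finrank_le_prod_natDegree _ hadj p hp0 fun i => ?_
    rw [Polynomial.aeval_algHom_apply]
    exact Ideal.Quotient.eq_zero_iff_mem.2 (Ideal.subset_span ⟨i, rfl⟩)
  have h : Module.finrank K (R ⧸ J) + Module.finrank K (J.restrictScalars K) = Module.finrank K R :=
    Submodule.finrank_quotient_add_finrank (J.restrictScalars K)
  exact h ▸ Nat.add_le_add hQ hJ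


/-- If `A₁, ..., A_l` is a commuting family of `n × n` complex matrices and `𝓕` is the
unital `ℂ`-subalgebra of `Matrix (Fin n) (Fin n) ℂ` they generate, then
`dim_ℂ 𝓕 ≤ (l+1) * n ^ (2 - 2/(l+1))`. -/
theorem dim_commutative_matrix_algebra_le
    (n l : ℕ) (hn : 1 ≤ n) (hl : 1 ≤ l)
    (A : Fin l → Matrix (Fin n) (Fin n) ℂ)
    (hcomm : ∀ i j, Commute (A i) (A j)) :
    (Module.finrank ℂ ↥(Algebra.adjoin ℂ (Set.range A)) : ℝ) ≤
      ((l : ℝ) + 1) * (n : ℝ) ^ ((2 : ℝ) - 2 / ((l : ℝ) + 1)) := by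
  obtain ⟨S, hS⟩ : ∃ S, S = Algebra.adjoin ℂ (Set.range A) := ⟨_, rfl⟩
  rw [← hS]
  have hA : ∀ i, A i ∈ S := fun i => hS ▸ Algebra.subset_adjoin ⟨i, rfl⟩
  have : IsMulCommutative S := hS ▸ Algebra.isMulCommutative_adjoin ℂ (by
    rintro _ ⟨i, rfl⟩ _ ⟨j, rfl⟩
    exact hcomm i j)
  have hn0 : (0 : ℝ) < n := by exact_mod_cast hn
  have hl0 : (0 : ℝ) < (l : ℝ) + 1 := by positivity
  set κ : ℝ := (n : ℝ) ^ (2 / ((l : ℝ) + 1)) with hκ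
  have hκ0 : 0 < κ := Real.rpow_pos_of_pos hn0 _
  let φ : S →ₐ[ℂ] Module.End ℂ (Fin n → ℂ) := Matrix.toLinAlgEquiv'.toAlgHom.comp S.val
  have hφ : Function.Injective φ := Matrix.toLinAlgEquiv'.injective.comp Subtype.val_injective
  have hgen : Algebra.adjoin ℂ (Set.range fun i => (⟨A i, hA i⟩ : S)) = ⊤ := by
    apply Subalgebra.map_injective (f := S.val) Subtype.val_injective
    rw [AlgHom.map_adjoin, ← Set.range_comp, Algebra.map_top, Subalgebra.range_val]
    exact hS.symm
  open scoped IsMulCommutative in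
  obtain ⟨d, hd, hle⟩ := Algebra.exists_finrank_le_prod_add φ hφ
    (fun i => (⟨A i, hA i⟩ : S)) hgen ⌊(n : ℝ) / κ⌋₊
  have hdκ : ∀ i, (d i : ℝ) ≤ κ := fun i => by
    have h1 : (d i : ℝ) * (⌊(n : ℝ) / κ⌋₊ + 1) ≤ n := by
      have := hd i
      rw [Module.finrank_fin_fun] at this
      exact_mod_cast this
    have h2 : (n : ℝ) / κ < ⌊(n : ℝ) / κ⌋₊ + 1 := Nat.lt_floor_add_one _
    have h3 : (d i : ℝ) * (n / κ) ≤ n := le_trans (by gcongr) h1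
    rw [← mul_div_assoc, div_le_iff₀ hκ0, mul_comm] at h3
    exact le_of_mul_le_mul_left h3 hn0
  have hfloor : (⌊(n : ℝ) / κ⌋₊ : ℝ) ≤ n / κ := Nat.floor_le (by positivity)
  have hprod : (∏ i, (d i : ℝ)) ≤ κ ^ l := by
    simpa using Finset.prod_le_prod (s := Finset.univ) (fun i _ => Nat.cast_nonneg (d i))
      fun i _ => hdκ i
  have e1 : κ ^ l = (n : ℝ) ^ ((2 : ℝ) - 2 / ((l : ℝ) + 1)) := by
    rw [hκ, ← Real.rpow_natCast, ← Real.rpow_mul hn0.le]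
    congr 1
    field_simp
    ring
  have e2 : n / κ * n = (n : ℝ) ^ ((2 : ℝ) - 2 / ((l : ℝ) + 1)) := by
    rw [Real.rpow_sub hn0, Real.rpow_two]
    ring
  have hle' : (Module.finrank ℂ S : ℝ) ≤ ∏ i, (d i : ℝ) + l * (⌊(n : ℝ) / κ⌋₊ * n) := by
    rw [Module.finrank_fin_fun, Fintype.card_fin] at hle
    exact_mod_cast hle
  calc (Module.finrank ℂ S : ℝ) ≤ ∏ i, (d i : ℝ) + l * (⌊(n : ℝ) / κ⌋₊ * n) := hle'
    _ ≤ κ ^ l + l * (n / κ * n) := by gcongr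
    _ = _ := by rw [e1, e2]; ring
end

section
/- Let A₁, A₂, ..., A_l be a commuting family of nilpotent matrices in M_{n×n}(ℂ), let 𝓕 be the unital ℂ-subalgebra of M_{n×n}(ℂ) generated by A₁, ..., A_l, and let x ≥ 1 be a natural number. Then dim_ℂ 𝓕 ≤ l·n²/x + x^l. -/
open Module in
/-- If `T ^ x` sends no nonzero vector of `U` into the range of `T ^ (x + 1)`, then
`U, T U, ..., T ^ (x - 1) U` are independent copies of `U`. -/
theorem Module.End.mul_finrank_le_of_pow_apply_notMem_range {K V : Type*} [Field K]
    [AddCommGroup V] [Module K V] [FiniteDimensional K V] (T : Module.End K V) (x : ℕ)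
    (U : Submodule K V)
    (hU : ∀ u ∈ U, (T ^ x) u ∈ LinearMap.range (T ^ (x + 1)) → u = 0) :
    x * finrank K U ≤ finrank K V := by
  let f : (Fin x → U) →ₗ[K] V :=
    ∑ i : Fin x, (T ^ (i : ℕ)) ∘ₗ U.subtype ∘ₗ LinearMap.proj i
  have hf : Function.Injective f := by
    rw [injective_iff_map_eq_zero]
    intro u hu
    have hzero : ∀ k : ℕ, ∀ i : Fin x, (i : ℕ) = k → u i = 0 := by
      intro k
      induction k using Nat.strong_induction_on with
      | _ k ih =>
        intro i hi
        have hsum : ∑ j : Fin x, (T ^ (x - k)) ((T ^ (j : ℕ)) (u j)) = 0 := by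
          rw [← map_sum, ← map_zero (T ^ (x - k)), ← hu]
          simp [f]
        rw [← Finset.add_sum_erase _ _ (Finset.mem_univ i)] at hsum
        have hix := i.2
        have hrest : ∑ j ∈ Finset.univ.erase i, (T ^ (x - k)) ((T ^ (j : ℕ)) (u j)) ∈
            LinearMap.range (T ^ (x + 1)) := by
          refine Submodule.sum_mem _ fun j hj => ?_
          rcases lt_trichotomy (j : ℕ) k with h | h | h
          · simp [ih j h j rfl]
          · exact absurd (Fin.ext (h.trans hi.symm)) (Finset.ne_of_mem_erase hj)
          · refine ⟨(T ^ ((j : ℕ) - k - 1)) (u j), ?_⟩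
            rw [← Module.End.mul_apply, ← Module.End.mul_apply, ← pow_add, ← pow_add]
            congr 2
            omega
        have hpow : (T ^ (x - k)) ((T ^ (i : ℕ)) (u i)) = (T ^ x) (u i) := by
          rw [← Module.End.mul_apply, ← pow_add]
          congr 2
          omega
        rw [hpow] at hsum
        refine Subtype.ext (hU _ (u i).2 ?_)
        rw [eq_neg_of_add_eq_zero_left hsum]
        exact Submodule.neg_mem _ hrest
    exact funext fun i => hzero i i rfl
  simpa [finrank_pi_fintype] using LinearMap.finrank_le_finrank_of_injective hf

open Module in
/-- If `T` is nilpotent and `S` is a space of endomorphisms commuting with `T`, then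
`x * dim (T ^ x S) ≤ (dim V) ^ 2`. -/
theorem Module.End.mul_finrank_map_mulLeft_pow_le {K V : Type*} [Field K]
    [AddCommGroup V] [Module K V] [FiniteDimensional K V] {T : Module.End K V}
    (hT : IsNilpotent T) (x : ℕ) (S : Submodule K (Module.End K V))
    (hS : ∀ B ∈ S, Commute T B) :
    x * finrank K (S.map (LinearMap.mulLeft K (T ^ x))) ≤ finrank K V ^ 2 := by
  let q : V →ₗ[K] V ⧸ LinearMap.range (T ^ (x + 1)) :=
    (LinearMap.range (T ^ (x + 1))).mkQ ∘ₗ T ^ x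
  have hq : ∀ v, v ∈ LinearMap.ker q ↔ (T ^ x) v ∈ LinearMap.range (T ^ (x + 1)) := by
    intro v
    simp only [q, LinearMap.mem_ker, LinearMap.comp_apply, Submodule.mkQ_apply,
      Submodule.Quotient.mk_eq_zero]
  obtain ⟨U, hU⟩ := Submodule.exists_isCompl (LinearMap.ker q)
  have hUdim : x * finrank K U ≤ finrank K V := by
    refine T.mul_finrank_le_of_pow_apply_notMem_range x U fun u hu h => ?_
    exact Submodule.disjoint_def.1 hU.disjoint u ((hq u).2 h) hu
  let g : S.map (LinearMap.mulLeft K (T ^ x)) →ₗ[K] (U →ₗ[K] V) :=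
    LinearMap.lcomp K V U.subtype ∘ₗ Submodule.subtype _
  have hg : Function.Injective g := by
    rw [injective_iff_map_eq_zero]
    rintro ⟨_, B, hB, rfl⟩ h
    have hcomm : Commute T B := hS B hB
    have hBU : ∀ u ∈ U, (T ^ x) (B u) = 0 := fun u hu => LinearMap.congr_fun h ⟨u, hu⟩
    have hswap : ∀ k v, (T ^ k) (B v) = B ((T ^ k) v) := fun k v =>
      LinearMap.congr_fun (hcomm.pow_left k).eq v
    have hstep : ∀ v, ∃ w, (T ^ x) (B v) = T ((T ^ x) (B w)) := by
      intro v
      obtain ⟨a, ha, u, hu, rfl⟩ :=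
        Submodule.mem_sup.1 (hU.sup_eq_top ▸ Submodule.mem_top : v ∈ LinearMap.ker q ⊔ U)
      obtain ⟨w, hw⟩ := (hq a).1 ha
      refine ⟨w, ?_⟩
      rw [map_add, map_add, hBU u hu, add_zero, hswap, ← hw, ← hswap, pow_succ']
      rfl
    have hiter : ∀ k v, ∃ w, (T ^ x) (B v) = (T ^ k) ((T ^ x) (B w)) := by
      intro k
      induction k with
      | zero => exact fun v => ⟨v, rfl⟩
      | succ k ih =>
        intro v
        obtain ⟨w, hw⟩ := ih v
        obtain ⟨w', hw'⟩ := hstep w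
        exact ⟨w', by rw [hw, hw', pow_succ]; rfl⟩
    obtain ⟨k, hk⟩ := hT
    refine Subtype.ext (LinearMap.ext fun v => ?_)
    obtain ⟨w, hw⟩ := hiter k v
    rw [hk] at hw
    exact hw
  have hle := LinearMap.finrank_le_finrank_of_injective hg
  rw [finrank_linearMap] at hle
  calc x * finrank K (S.map (LinearMap.mulLeft K (T ^ x)))
      ≤ x * (finrank K U * finrank K V) := Nat.mul_le_mul_left _ hle
    _ = (x * finrank K U) * finrank K V := (mul_assoc _ _ _).symm
    _ ≤ finrank K V ^ 2 := by rw [sq]; exact Nat.mul_le_mul_right _ hUdim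

open scoped IsMulCommutative in
/-- The subalgebra generated by a commuting family is a quotient of a polynomial algebra. -/
theorem Algebra.exists_mvPolynomial_range_eq_adjoin {K R σ : Type*} [CommSemiring K]
    [Semiring R] [Algebra K R] (a : σ → R) (ha : ∀ i j, Commute (a i) (a j)) :
    ∃ φ : MvPolynomial σ K →ₐ[K] R,
      (∀ i, φ (MvPolynomial.X i) = a i) ∧ φ.range = Algebra.adjoin K (Set.range a) := by
  have : IsMulCommutative (Algebra.adjoin K (Set.range a)) :=
    Algebra.isMulCommutative_adjoin K (by rintro _ ⟨i, rfl⟩ _ ⟨j, rfl⟩; exact ha i j)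
  let φ : MvPolynomial σ K →ₐ[K] R := (Algebra.adjoin K (Set.range a)).val.comp
    (MvPolynomial.aeval fun i =>
      (⟨a i, Algebra.subset_adjoin ⟨i, rfl⟩⟩ : Algebra.adjoin K (Set.range a)))
  have hφ : ∀ i, φ (MvPolynomial.X i) = a i := fun i =>
    congrArg Subtype.val (MvPolynomial.aeval_X _ i)
  refine ⟨φ, hφ, ?_⟩
  rw [← Algebra.map_top, ← MvPolynomial.adjoin_range_X, AlgHom.map_adjoin, ← Set.range_comp]
  exact congrArg _ (congrArg _ (funext hφ))

open Module in
/-- A monomial either has all exponents `< x` or is divisible by the `x`-th power of a variable. -/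
theorem MvPolynomial.finrank_range_le {K R σ : Type*} [Field K] [Ring R] [Algebra K R]
    [FiniteDimensional K R] [Fintype σ] (φ : MvPolynomial σ K →ₐ[K] R) (x : ℕ) :
    finrank K φ.range ≤ x ^ Fintype.card σ + ∑ i, finrank K
      ((Subalgebra.toSubmodule φ.range).map (LinearMap.mulLeft K (φ (X i) ^ x))) := by
  classical
  let W : σ → Submodule K R := fun i =>
    (Subalgebra.toSubmodule φ.range).map (LinearMap.mulLeft K (φ (X i) ^ x))
  let g : (σ → Fin x) → R := fun e =>
    φ (monomial (Finsupp.equivFunOnFinite.symm fun i => (e i : ℕ)) 1)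
  have hmono : ∀ m : σ →₀ ℕ,
      φ (monomial m 1) ∈ Submodule.span K (Set.range g) ⊔ Finset.univ.sup W := by
    intro m
    by_cases hm : ∀ i, m i < x
    · refine Submodule.mem_sup_left (Submodule.subset_span ⟨fun i => ⟨m i, hm i⟩, ?_⟩)
      simp only [g]
      congr 2
      ext i
      simp
    · push Not at hm
      obtain ⟨i, hi⟩ := hm
      refine Submodule.mem_sup_right (Finset.le_sup (f := W) (Finset.mem_univ i) ?_)
      refine ⟨φ (monomial (m - Finsupp.single i x) 1), ⟨_, rfl⟩, ?_⟩
      rw [LinearMap.mulLeft_apply, ← map_pow, ← map_mul, X_pow_eq_monomial, monomial_mul, one_mul,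
        add_tsub_cancel_of_le (Finsupp.single_le_iff.2 hi)]
  have hle : Subalgebra.toSubmodule φ.range ≤
      Submodule.span K (Set.range g) ⊔ Finset.univ.sup W := by
    rintro _ ⟨p, rfl⟩
    change φ p ∈ _
    rw [p.as_sum, map_sum]
    refine Submodule.sum_mem _ fun m _ => ?_
    rw [← mul_one (coeff m p), ← smul_eq_mul, ← smul_monomial, map_smul]
    exact Submodule.smul_mem _ _ (hmono m)
  have hsup : ∀ s : Finset σ, finrank K ↥(s.sup W) ≤ ∑ i ∈ s, finrank K (W i) := by
    intro s
    induction s using Finset.induction_on with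
    | empty => simp
    | insert i s hi ih =>
      rw [Finset.sup_insert, Finset.sum_insert hi]
      exact (Submodule.finrank_add_le_finrank_add_finrank _ _).trans (Nat.add_le_add_left ih _)
  have hspan : finrank K (Submodule.span K (Set.range g)) ≤ x ^ Fintype.card σ := by
    simpa [Set.finrank] using finrank_range_le_card (R := K) g
  calc finrank K φ.range
      ≤ finrank K ↥(Submodule.span K (Set.range g) ⊔ Finset.univ.sup W) :=
        Submodule.finrank_mono hle
    _ ≤ _ := (Submodule.finrank_add_le_finrank_add_finrank _ _).trans
        (Nat.add_le_add hspan (hsup _))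

open Module in
/-- The dimension bound for the algebra generated by commuting nilpotent endomorphisms. -/
theorem Module.End.mul_finrank_adjoin_le {K V σ : Type*} [Field K] [AddCommGroup V] [Module K V]
    [FiniteDimensional K V] [Fintype σ] (a : σ → Module.End K V)
    (hcomm : ∀ i j, Commute (a i) (a j)) (hnilp : ∀ i, IsNilpotent (a i)) (x : ℕ) :
    x * finrank K (Algebra.adjoin K (Set.range a)) ≤
      x * x ^ Fintype.card σ + Fintype.card σ * finrank K V ^ 2 := by
  obtain ⟨φ, hφ, hrange⟩ := Algebra.exists_mvPolynomial_range_eq_adjoin (K := K) a hcomm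
  rw [← hrange]
  refine (Nat.mul_le_mul_left x (MvPolynomial.finrank_range_le φ x)).trans ?_
  rw [mul_add, Finset.mul_sum]
  refine Nat.add_le_add_left ((Finset.sum_le_card_nsmul _ _ (finrank K V ^ 2)
    fun i _ => ?_).trans_eq (by simp)) _
  refine Module.End.mul_finrank_map_mulLeft_pow_le (by rw [hφ]; exact hnilp i) x _ ?_
  rintro _ ⟨p, rfl⟩
  exact (Commute.all (MvPolynomial.X i) p).map φ


/-- If `A₁, ..., A_l` is a commuting family of nilpotent `n × n` complex matrices, `𝓕` is the
unital `ℂ`-subalgebra they generate, and `x ≥ 1` is a natural number, then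
`dim_ℂ 𝓕 ≤ l * n² / x + x ^ l`. -/
theorem dim_commutative_nilpotent_matrix_algebra_le
    (n l : ℕ) (hn : 1 ≤ n) (hl : 1 ≤ l)
    (A : Fin l → Matrix (Fin n) (Fin n) ℂ)
    (hcomm : ∀ i j, Commute (A i) (A j))
    (hnilp : ∀ i, IsNilpotent (A i))
    (x : ℕ) (hx : 1 ≤ x) :
    (Module.finrank ℂ ↥(Algebra.adjoin ℂ (Set.range A)) : ℝ) ≤
      (l : ℝ) * (n : ℝ) ^ 2 / (x : ℝ) + (x : ℝ) ^ l := by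
  let e := Matrix.toLinAlgEquiv' (R := ℂ) (n := Fin n)
  have hrange : (Algebra.adjoin ℂ (Set.range A)).map (e : _ →ₐ[ℂ] _) =
      Algebra.adjoin ℂ (Set.range fun i => e (A i)) := by
    rw [AlgHom.map_adjoin, ← Set.range_comp]
    rfl
  have hfin : Module.finrank ℂ (Algebra.adjoin ℂ (Set.range A)) =
      Module.finrank ℂ (Algebra.adjoin ℂ (Set.range fun i => e (A i))) := by
    rw [← hrange]
    exact (LinearEquiv.finrank_map_eq e.toLinearEquiv
      (Subalgebra.toSubmodule (Algebra.adjoin ℂ (Set.range A)))).symm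
  have h := Module.End.mul_finrank_adjoin_le (fun i => e (A i))
    (fun i j => (hcomm i j).map e) (fun i => (hnilp i).map e) x
  rw [← hfin, Fintype.card_fin, Module.finrank_fin_fun] at h
  have hx' : (0 : ℝ) < x := by exact_mod_cast hx
  rw [div_add' _ _ _ hx'.ne', le_div_iff₀ hx']
  have h' : (x : ℝ) * Module.finrank ℂ (Algebra.adjoin ℂ (Set.range A)) ≤
      x * x ^ l + l * n ^ 2 := by exact_mod_cast h
  linarith
end

section
/- Let 𝓛 be an associative unital algebra over ℂ, let 𝓩 ⊆ 𝓐 be commutative subalgebras of 𝓛 with 𝓩 contained in the center of 𝓛, let A₁, ..., A_l ∈ 𝓐 be such that 𝓐 is the subalgebra of 𝓛 generated by 𝓩 together with A₁, ..., A_l, and let X₁, ..., X_p, Y₁, ..., Y_q ∈ 𝓛 be such that every element X ∈ 𝓛 can be written as X = Σ_{i=1}^{p} Σ_{j=1}^{q} Xᵢ Pᵢⱼ Yⱼ with Pᵢⱼ ∈ 𝓐. Then every irreducible finite-dimensional complex representation of 𝓛 has dimension at most (p·q)^{(l+1)/2} · (l+1)^{(l+1)/2}. -/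
open Polynomial in
/-- An endomorphism `b` of a finite-dimensional space over an infinite field has a vector whose
annihilating polynomials are all divisible by the minimal polynomial of `b`. -/
theorem exists_forall_minpoly_dvd {K W : Type*} [Field K] [Infinite K] [AddCommGroup W]
    [Module K W] [FiniteDimensional K W] (b : Module.End K W) :
    ∃ w : W, ∀ f : K[X], aeval b f w = 0 → minpoly K b ∣ f := by
  classical
  by_contra! hcon
  have hint : IsIntegral K b := Algebra.IsIntegral.isIntegral b
  have hmu : minpoly K b ≠ 0 := minpoly.ne_zero hint
  have : Finite {g : K[X] // g.Monic ∧ g ∣ minpoly K b} :=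
    @Finite.of_fintype _ (fintypeSubtypeMonicDvd _ hmu)
  let ι := {g : {g : K[X] // g.Monic ∧ g ∣ minpoly K b} // g.1 ≠ minpoly K b}
  have hcover : ⋃ i : ι, (LinearMap.ker (aeval b i.1.1) : Set W) = Set.univ := by
    refine Set.eq_univ_of_forall fun w => ?_
    obtain ⟨f, hf, hnd⟩ := hcon w
    set g := EuclideanDomain.gcd f (minpoly K b) with hg
    have hg0 : g ≠ 0 := fun h => hmu (EuclideanDomain.gcd_eq_zero_iff.mp h).2
    have hgw : aeval b g w = 0 := by
      rw [hg, EuclideanDomain.gcd_eq_gcd_ab, mul_comm f, mul_comm (minpoly K b)]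
      simp [hf]
    have hassoc : Associated (normalize g) g := normalize_associated g
    refine Set.mem_iUnion.mpr ⟨⟨⟨normalize g, monic_normalize hg0,
      hassoc.dvd.trans (EuclideanDomain.gcd_dvd_right _ _)⟩, fun h => hnd ?_⟩, ?_⟩
    · rw [← show normalize g = minpoly K b from h]
      exact hassoc.dvd.trans (EuclideanDomain.gcd_dvd_left _ _)
    · obtain ⟨c, hc⟩ := hassoc.symm.dvd
      have hc' : normalize g = c * g := by rw [mul_comm]; exact hc
      simp [hc', hgw]
  obtain ⟨⟨⟨g, hgm, hgd⟩, hgne⟩, hi⟩ := Subspace.exists_eq_top_of_iUnion_eq_univ hcover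
  have hg0 : aeval b g = 0 := LinearMap.ker_eq_top.mp hi
  exact hgne (eq_of_monic_of_associated hgm (minpoly.monic hint)
    (associated_of_dvd_dvd hgd (minpoly.dvd K b hg0)))

open Polynomial in
theorem Submodule.mkQ_aeval_mapQ {K W : Type*} [Field K] [AddCommGroup W] [Module K W]
    (a : Module.End K W) (M : Submodule K W) (h : M ≤ M.comap a) (f : K[X]) (v : W) :
    aeval (M.mapQ M a h) f (M.mkQ v) = M.mkQ (aeval a f v) := by
  induction f using Polynomial.induction_on' with
  | add f g hf hg => simp only [map_add, LinearMap.add_apply, hf, hg]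
  | monomial n c =>
    simp only [aeval_monomial, Module.algebraMap_end_eq_smul_id, LinearMap.smul_apply,
      Module.End.mul_apply, LinearMap.id_apply, map_smul]
    rw [← M.mapQ_pow h]
    simp

open Polynomial in
/-- For an endomorphism `a` of an `n`-dimensional space over an infinite field there are a monic
polynomial `f` of degree `d` and at most `n / (d + 1)` vectors such that the image of `f(a)` lies
in the `a`-invariant subspace generated by these vectors. -/
theorem exists_monic_range_aeval_le {K : Type*} [Field K] [Infinite K] (d n : ℕ) :
    ∀ (W : Type*) [AddCommGroup W] [Module K W] [FiniteDimensional K W]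
      (a : Module.End K W), Module.finrank K W = n →
    ∃ (f : K[X]) (s : Finset W), f.Monic ∧ f.natDegree = d ∧ s.card * (d + 1) ≤ n ∧
      ∀ N : Submodule K W, (∀ v ∈ N, a v ∈ N) → (∀ u ∈ s, u ∈ N) → ∀ v, aeval a f v ∈ N := by
  classical
  induction n using Nat.strong_induction_on with
  | _ n ih =>
  intro W _ _ _ a hn
  have hint : IsIntegral K a := Algebra.IsIntegral.isIntegral a
  by_cases hd : (minpoly K a).natDegree ≤ d
  · refine ⟨minpoly K a * X ^ (d - (minpoly K a).natDegree), ∅,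
      (minpoly.monic hint).mul (monic_X_pow _), ?_, by simp, ?_⟩
    · rw [(minpoly.monic hint).natDegree_mul (monic_X_pow _), natDegree_X_pow]
      omega
    · intro N _ _ v
      simp
  · push Not at hd
    obtain ⟨w, hw⟩ := exists_forall_minpoly_dvd a
    let M : Submodule K W := Submodule.span K (Set.range fun j : ℕ => (a ^ j) w)
    have hMinv : M ≤ M.comap a := by
      refine Submodule.span_le.mpr ?_
      rintro _ ⟨j, rfl⟩
      refine Submodule.subset_span ⟨j + 1, ?_⟩
      simp [pow_succ']
    have hli : LinearIndependent K fun j : Fin (d + 1) => (a ^ (j : ℕ)) w := by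
      rw [Fintype.linearIndependent_iff]
      intro c hc
      let f : K[X] := ∑ j : Fin (d + 1), monomial (j : ℕ) (c j)
      have hf : aeval a f w = 0 := by
        simpa [f, aeval_monomial, LinearMap.sum_apply, Module.algebraMap_end_eq_smul_id] using hc
      have hdeg : f.natDegree ≤ d := by
        refine natDegree_sum_le_of_forall_le _ _ fun j _ => ?_
        exact (natDegree_monomial_le _).trans (Nat.lt_succ_iff.mp j.2)
      have hf0 : f = 0 :=
        eq_zero_of_dvd_of_natDegree_lt (hw f hf) (hdeg.trans_lt hd)
      intro i
      have := congrArg (fun g => g.coeff (i : ℕ)) hf0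
      simpa [f, finsetSum_coeff, coeff_monomial, Fin.val_inj] using this
    have hMdim : d + 1 ≤ Module.finrank K M := by
      have h1 := finrank_span_eq_card hli
      rw [Fintype.card_fin] at h1
      rw [← h1]
      refine Submodule.finrank_mono (Submodule.span_mono ?_)
      rintro _ ⟨j, rfl⟩
      exact ⟨j, rfl⟩
    have hq := M.finrank_quotient_add_finrank
    obtain ⟨f, s, hfm, hfd, hs, hN⟩ :=
      ih (Module.finrank K (W ⧸ M)) (by omega) (W ⧸ M) (M.mapQ M a hMinv) rfl
    refine ⟨f, insert w (s.image Quotient.out), hfm, hfd, ?_, ?_⟩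
    · have h1 : (insert w (s.image Quotient.out)).card ≤ s.card + 1 :=
        (Finset.card_insert_le _ _).trans (Nat.succ_le_succ Finset.card_image_le)
      calc _ ≤ (s.card + 1) * (d + 1) := Nat.mul_le_mul_right _ h1
        _ ≤ n := by rw [add_mul]; omega
    · intro N hNa hNs v
      have hMN : M ≤ N := by
        refine Submodule.span_le.mpr ?_
        rintro _ ⟨j, rfl⟩
        induction j with
        | zero => simpa using hNs w (by simp)
        | succ j ihj => simpa [pow_succ'] using hNa _ ihj
      have hmem := hN (N.map M.mkQ) ?_ ?_ (M.mkQ v)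
      · rw [Submodule.mkQ_aeval_mapQ] at hmem
        obtain ⟨y, hy, hyv⟩ := hmem
        have : aeval a f v - y ∈ M := by
          rw [← Submodule.ker_mkQ M, LinearMap.mem_ker, map_sub, hyv, sub_self]
        simpa using N.add_mem (hMN this) hy
      · rintro _ ⟨y, hy, rfl⟩
        exact ⟨a y, hNa y hy, by simp⟩
      · intro u hu
        exact ⟨Quotient.out u, hNs _ (Finset.mem_insert_of_mem (Finset.mem_image_of_mem _ hu)),
          Quotient.out_eq _⟩

open Polynomial in
/-- A commutative algebra generated by `l` elements, each killed by a monic polynomial of degree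
`d`, has dimension at most `d ^ l`. -/
theorem finrank_adjoin_image_le_pow {K Q ι : Type*} [Field K] [CommRing Q] [Algebra K Q]
    (c : ι → Q) (f : ι → K[X]) (d : ℕ) (hfm : ∀ i, (f i).Monic)
    (hfd : ∀ i, (f i).natDegree = d) (hf : ∀ i, aeval (c i) (f i) = 0) (s : Finset ι) :
    Module.finrank K (Algebra.adjoin K (c '' s)) ≤ d ^ s.card := by
  classical
  have hsingle (i : ι) : Module.finrank K (Algebra.adjoin K {c i}) ≤ d := by
    have hint : IsIntegral K (c i) := ⟨f i, hfm i, hf i⟩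
    rw [(Algebra.adjoin.powerBasis hint).finrank, Algebra.adjoin.powerBasis_dim, ← hfd i]
    exact natDegree_le_of_dvd (minpoly.dvd K _ (hf i)) (hfm i).ne_zero
  induction s using Finset.induction_on with
  | empty =>
    rw [Finset.coe_empty, Set.image_empty, Algebra.adjoin_empty, Finset.card_empty, pow_zero]
    exact (LinearMap.finrank_range_le (Algebra.linearMap K Q)).trans_eq (Module.finrank_self K)
  | insert i s hi ih =>
    rw [Finset.coe_insert, Set.image_insert_eq, Set.insert_eq, Algebra.adjoin_union,
      Finset.card_insert_of_notMem hi, pow_succ']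
    exact (Subalgebra.finrank_sup_le_of_free _ _).trans (Nat.mul_le_mul (hsingle i) ih)

open Polynomial in
/-- A commutative algebra generated by `l` elements and acting faithfully on an `n`-dimensional
space over an infinite field has dimension at most `d ^ l + l * (n * (n / (d + 1)))`,
for every `d`. -/
theorem finrank_le_of_adjoin_eq_top {K R V : Type*} [Field K] [Infinite K] [CommRing R]
    [Algebra K R] [AddCommGroup V] [Module K V] [FiniteDimensional K V]
    (φ : R →ₐ[K] Module.End K V) (hφ : Function.Injective φ)
    {l : ℕ} (c : Fin l → R) (hc : Algebra.adjoin K (Set.range c) = ⊤) (d : ℕ) :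
    Module.finrank K R ≤
      d ^ l + l * (Module.finrank K V * (Module.finrank K V / (d + 1))) := by
  classical
  set n := Module.finrank K V with hn
  have : FiniteDimensional K R := FiniteDimensional.of_injective φ.toLinearMap hφ
  choose f s hfm hfd hs hN using
    fun i => exists_monic_range_aeval_le (K := K) d n V (φ (c i)) rfl
  let g : Fin l → R := fun i => aeval (c i) (f i)
  have hrange (i : Fin l) :
      Module.finrank K (LinearMap.range (LinearMap.mulLeft K (g i))) ≤ n * (n / (d + 1)) := by
    let E : R →ₗ[K] (s i → V) := LinearMap.pi fun u => (LinearMap.applyₗ u.1) ∘ₗ φ.toLinearMap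
    have hker : LinearMap.ker E ≤ LinearMap.ker (LinearMap.mulLeft K (g i)) := by
      intro x hx
      have hx' : ∀ u ∈ s i, φ x u = 0 := fun u hu => congrFun (LinearMap.mem_ker.mp hx) ⟨u, hu⟩
      rw [LinearMap.mem_ker, LinearMap.mulLeft_apply, mul_comm]
      apply hφ
      ext v
      have := hN i (LinearMap.ker (φ x)) ?_ hx' v
      · simpa [g, ← aeval_algHom_apply] using this
      · intro v hv
        rw [LinearMap.mem_ker] at hv ⊢
        rw [← Module.End.mul_apply, ← map_mul, mul_comm, map_mul, Module.End.mul_apply, hv,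
          map_zero]
    have h1 := LinearMap.finrank_range_add_finrank_ker E
    have h2 := LinearMap.finrank_range_add_finrank_ker (LinearMap.mulLeft K (g i))
    have h3 := Submodule.finrank_mono hker
    have h4 : Module.finrank K (LinearMap.range E) ≤ (s i).card * n := by
      refine (Submodule.finrank_le _).trans_eq ?_
      rw [Module.finrank_pi_fintype]
      simp [hn]
    have h5 : (s i).card ≤ n / (d + 1) := (Nat.le_div_iff_mul_le d.succ_pos).mpr (hs i)
    have h6 := Nat.mul_le_mul_right n h5
    rw [mul_comm n]
    omega
  let J : Ideal R := Ideal.span (Set.range g)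
  have hJ : Module.finrank K (J.restrictScalars K) ≤ l * (n * (n / (d + 1))) := by
    have hle : J.restrictScalars K ≤
        ⨆ i ∈ (Finset.univ : Finset (Fin l)), LinearMap.range (LinearMap.mulLeft K (g i)) := by
      intro x hx
      obtain ⟨y, rfl⟩ := Ideal.mem_span_range_iff_exists_fun.mp
        (show x ∈ Ideal.span (Set.range g) from hx)
      refine Submodule.sum_mem _ fun i hi => Submodule.mem_iSup_of_mem i
        (Submodule.mem_iSup_of_mem hi ⟨y i, mul_comm _ _⟩)
    have hsup (t : Finset (Fin l)) : Module.finrank K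
        (⨆ i ∈ t, LinearMap.range (LinearMap.mulLeft K (g i)) : Submodule K R) ≤
        t.card * (n * (n / (d + 1))) := by
      induction t using Finset.induction_on with
      | empty => simp
      | insert i t hi ih =>
        rw [Finset.iSup_insert, Finset.card_insert_of_notMem hi, add_mul, one_mul, add_comm]
        exact (Submodule.finrank_add_le_finrank_add_finrank _ _).trans
          (Nat.add_le_add (hrange i) ih)
    simpa using (Submodule.finrank_mono hle).trans (hsup Finset.univ)
  have hQ : Module.finrank K (R ⧸ J) ≤ d ^ l := by
    let c' : Fin l → R ⧸ J := fun i => Ideal.Quotient.mkₐ K J (c i)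
    have hc' : Algebra.adjoin K (c' '' (Finset.univ : Finset (Fin l))) = ⊤ := by
      have : c' '' (Finset.univ : Finset (Fin l)) =
          Ideal.Quotient.mkₐ K J '' Set.range c := by
        rw [Finset.coe_univ, Set.image_univ, ← Set.range_comp]; rfl
      rw [this, ← AlgHom.map_adjoin, hc, Algebra.map_top, AlgHom.range_eq_top]
      exact Ideal.Quotient.mkₐ_surjective K J
    have := finrank_adjoin_image_le_pow c' f d hfm hfd (fun i => by
      rw [aeval_algHom_apply]
      exact Ideal.Quotient.eq_zero_iff_mem.mpr (Ideal.subset_span ⟨i, rfl⟩)) Finset.univ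
    rw [hc', Finset.card_univ, Fintype.card_fin] at this
    exact Subalgebra.topEquiv.toLinearEquiv.finrank_eq.symm.trans_le this
  have hsum := Submodule.finrank_quotient_add_finrank (J.restrictScalars K)
  have hQ' : Module.finrank K (R ⧸ J.restrictScalars K) ≤ d ^ l := hQ
  omega

open scoped IsMulCommutative in
/-- The algebra generated by `l` commuting endomorphisms of an `n`-dimensional space over an
infinite field has dimension at most `d ^ l + l * (n * (n / (d + 1)))`, for every `d`. -/
theorem finrank_adjoin_range_le_of_commute {K V : Type*} [Field K] [Infinite K]
    [AddCommGroup V] [Module K V] [FiniteDimensional K V] {l : ℕ} (c : Fin l → Module.End K V)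
    (hc : ∀ i j, Commute (c i) (c j)) (d : ℕ) :
    Module.finrank K (Algebra.adjoin K (Set.range c)) ≤
      d ^ l + l * (Module.finrank K V * (Module.finrank K V / (d + 1))) := by
  have : IsMulCommutative (Algebra.adjoin K (Set.range c)) :=
    Algebra.isMulCommutative_adjoin K (by rintro _ ⟨i, rfl⟩ _ ⟨j, rfl⟩; exact hc i j)
  refine finrank_le_of_adjoin_eq_top (Algebra.adjoin K (Set.range c)).val Subtype.val_injective
    (fun i => ⟨c i, Algebra.subset_adjoin ⟨i, rfl⟩⟩) ?_ d
  refine Eq.trans (congrArg (Algebra.adjoin K) ?_)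
    (Algebra.adjoin_adjoin_coe_preimage (R := K) (s := Set.range c))
  ext y
  exact exists_congr fun i => Subtype.ext_iff

/-- **Schur's lemma** for a family of operators without common invariant subspaces. -/
theorem exists_eq_algebraMap_of_commute {K L V : Type*} [Field K] [IsAlgClosed K]
    [AddCommGroup V] [Module K V] [FiniteDimensional K V] [Nontrivial V]
    (ρ : L → Module.End K V)
    (hirred : ∀ W : Submodule K V, (∀ x : L, ∀ v ∈ W, ρ x v ∈ W) → W = ⊥ ∨ W = ⊤)
    (g : Module.End K V) (hg : ∀ x, Commute g (ρ x)) :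
    ∃ μ : K, g = algebraMap K (Module.End K V) μ := by
  obtain ⟨μ, hμ⟩ := Module.End.exists_eigenvalue g
  refine ⟨μ, ?_⟩
  have htop : g.eigenspace μ = ⊤ := by
    refine (hirred _ fun x v hv => ?_).resolve_left hμ
    rw [Module.End.mem_eigenspace_iff] at hv ⊢
    rw [← Module.End.mul_apply, (hg x).eq, Module.End.mul_apply, hv, map_smul]
  ext v
  have : v ∈ g.eigenspace μ := htop ▸ Submodule.mem_top
  simpa [Module.algebraMap_end_eq_smul_id] using Module.End.mem_eigenspace_iff.mp this

/-- **Burnside's theorem**: an irreducible finite-dimensional representation of an algebra over an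
algebraically closed field is surjective. -/
theorem AlgHom.surjective_of_irreducible {K L V : Type*} [Field K] [IsAlgClosed K] [Ring L]
    [Algebra K L] [AddCommGroup V] [Module K V] [FiniteDimensional K V] [Nontrivial V]
    (ρ : L →ₐ[K] Module.End K V)
    (hirred : ∀ W : Submodule K V, (∀ x : L, ∀ v ∈ W, ρ x v ∈ W) → W = ⊥ ∨ W = ⊤) :
    Function.Surjective ρ := by
  classical
  let : Module L V := Module.compHom V ρ.toRingHom
  have hsmul (x : L) (v : V) : x • v = ρ x v := rfl
  have halg (k : K) (v : V) : (algebraMap K L k) • v = k • v := by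
    rw [hsmul, AlgHom.commutes, Module.algebraMap_end_apply]
  have : IsSimpleModule L V := by
    rw [isSimpleModule_iff]
    refine { exists_pair_ne := ⟨⊥, ⊤, bot_ne_top⟩, eq_bot_or_eq_top := fun W => ?_ }
    let W' : Submodule K V :=
      { W.toAddSubmonoid with smul_mem' := fun k v hv => halg k v ▸ W.smul_mem _ hv }
    refine (hirred W' fun x v hv => W.smul_mem x hv).imp (fun h => ?_) fun h => ?_
    · exact SetLike.coe_injective (congrArg (fun U : Submodule K V => (U : Set V)) h)
    · exact SetLike.coe_injective (congrArg (fun U : Submodule K V => (U : Set V)) h)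
  intro f
  have hscalar (g : Module.End L V) : ∃ μ : K, ∀ v, g v = μ • v := by
    let g' : Module.End K V :=
      { toFun := g
        map_add' := map_add g
        map_smul' := fun k v => by
          rw [← halg, map_smul, halg, RingHom.id_apply] }
    obtain ⟨μ, hμ⟩ := exists_eq_algebraMap_of_commute ρ hirred g'
      (fun x => LinearMap.ext fun v => g.map_smul x v)
    refine ⟨μ, fun v => ?_⟩
    rw [← Module.algebraMap_end_apply K K V μ v, ← hμ]
    rfl
  let f' : Module.End (Module.End L V) V :=
    { toFun := f
      map_add' := map_add f
      map_smul' := fun g v => by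
        obtain ⟨μ, hμ⟩ := hscalar g
        simp only [RingHom.id_apply, Module.End.smul_def, hμ, map_smul] }
  let b := Module.finBasis K V
  obtain ⟨r, hr⟩ := jacobson_density (R := L) f' (Finset.univ.image b)
  exact ⟨r, b.ext fun i => (hr (b i) (by simp)).symm⟩

/-- If every endomorphism of `V` is of the form `∑ i, ∑ j, X i * P i j * Y j` with `P i j ∈ B`,
then `(dim V)² ≤ p q dim B`. -/
theorem sq_finrank_le_of_forall_eq_sum {K V : Type*} [Field K] [AddCommGroup V] [Module K V]
    [FiniteDimensional K V] (B : Subalgebra K (Module.End K V)) {p q : ℕ}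
    (X : Fin p → Module.End K V) (Y : Fin q → Module.End K V)
    (h : ∀ x : Module.End K V, ∃ P : Fin p → Fin q → Module.End K V,
      (∀ i j, P i j ∈ B) ∧ x = ∑ i, ∑ j, X i * P i j * Y j) :
    Module.finrank K V ^ 2 ≤ p * q * Module.finrank K B := by
  let T : (Fin p → Fin q → B) →ₗ[K] Module.End K V := ∑ i, ∑ j,
    LinearMap.mulRight K (Y j) ∘ₗ LinearMap.mulLeft K (X i) ∘ₗ B.val.toLinearMap ∘ₗ
      LinearMap.proj j ∘ₗ LinearMap.proj i
  have hT : Function.Surjective T := by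
    intro x
    obtain ⟨P, hP, rfl⟩ := h x
    refine ⟨fun i j => ⟨P i j, hP i j⟩, ?_⟩
    simp [T, LinearMap.sum_apply]
  have := LinearMap.finrank_le_finrank_of_surjective hT
  rw [Module.finrank_linearMap, ← sq] at this
  refine this.trans_eq ?_
  simp [Module.finrank_pi_fintype, mul_assoc]

theorem le_rpow_of_sq_le {n l m : ℕ} (hn : 0 < n)
    (h : ∀ d : ℕ, n ^ 2 ≤ m * (d ^ l + l * (n * (n / (d + 1))))) :
    (n : ℝ) ≤ ((m : ℝ) * ((l : ℝ) + 1)) ^ (((l : ℝ) + 1) / 2) := by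
  have hn' : (0 : ℝ) < n := by exact_mod_cast hn
  have hl : (0 : ℝ) < (l : ℝ) + 1 := by positivity
  set x : ℝ := (n : ℝ) ^ (2 / ((l : ℝ) + 1)) with hx
  have hx0 : 0 < x := Real.rpow_pos_of_pos hn' _
  have hxn : x ^ (((l : ℝ) + 1) / 2) = n := by
    rw [hx, ← Real.rpow_mul hn'.le]
    field_simp
    simp
  have hxl : x ^ (l + 1) = (n : ℝ) ^ 2 := by
    rw [hx, ← Real.rpow_natCast, ← Real.rpow_mul hn'.le, ← Real.rpow_natCast]
    congr 1
    push_cast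
    field_simp
  have hd1 : ((⌊x⌋₊ : ℕ) : ℝ) ≤ x := Nat.floor_le hx0.le
  have hd2 : x < (⌊x⌋₊ : ℝ) + 1 := Nat.lt_floor_add_one x
  have hdiv : (n : ℝ) * ((n / (⌊x⌋₊ + 1) : ℕ) : ℝ) ≤ x ^ l := by
    have h1 : ((n / (⌊x⌋₊ + 1) : ℕ) : ℝ) ≤ n / x := by
      refine Nat.cast_div_le.trans ?_
      push_cast
      gcongr
    calc (n : ℝ) * ((n / (⌊x⌋₊ + 1) : ℕ) : ℝ) ≤ n * (n / x) := by gcongr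
      _ = x ^ l := by
        rw [← mul_div_assoc, ← sq, ← hxl, pow_succ]
        field_simp
  have hpow : ((⌊x⌋₊ : ℕ) : ℝ) ^ l ≤ x ^ l := by gcongr
  have hmain : x ^ l * x ≤ x ^ l * (m * ((l : ℝ) + 1)) := by
    have h1 : (n : ℝ) ^ 2 ≤
        m * ((⌊x⌋₊ : ℝ) ^ l + l * (n * ((n / (⌊x⌋₊ + 1) : ℕ) : ℝ))) := by
      exact_mod_cast h ⌊x⌋₊
    calc x ^ l * x = (n : ℝ) ^ 2 := by rw [← hxl, pow_succ]
      _ ≤ _ := h1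
      _ ≤ m * (x ^ l + l * x ^ l) := by gcongr
      _ = _ := by ring
  have hxm := le_of_mul_le_mul_left hmain (pow_pos hx0 l)
  rw [← hxn]
  exact Real.rpow_le_rpow hx0.le hxm (by positivity)


/-- Bernstein's lemma on associative algebras: if `𝓩 ⊆ 𝓐` are commutative subalgebras of a
unital associative `ℂ`-algebra `𝓛`, `𝓩` is central, `𝓐` is generated by `𝓩` together with
`A₁, ..., A_l`, and there exist `X₁, ..., X_p, Y₁, ..., Y_q ∈ 𝓛` such that every element of `𝓛`
is of the form `Σᵢⱼ Xᵢ Pᵢⱼ Yⱼ` with `Pᵢⱼ ∈ 𝓐`, then every irreducible finite-dimensional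
complex representation of `𝓛` has dimension at most `(pq)^((l+1)/2) * (l+1)^((l+1)/2)`. -/
theorem dim_irreducible_rep_le
    (L : Type*) [Ring L] [Algebra ℂ L]
    (𝓩 𝓐 : Subalgebra ℂ L)
    (h𝓩𝓐 : 𝓩 ≤ 𝓐)
    (h𝓩center : 𝓩 ≤ Subalgebra.center ℂ L)
    (h𝓩comm : ∀ a ∈ 𝓩, ∀ b ∈ 𝓩, a * b = b * a)
    (h𝓐comm : ∀ a ∈ 𝓐, ∀ b ∈ 𝓐, a * b = b * a)
    (l : ℕ) (A : Fin l → L) (hA : ∀ i, A i ∈ 𝓐)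
    (h𝓐gen : 𝓐 = Algebra.adjoin ℂ ((𝓩 : Set L) ∪ Set.range A))
    (p q : ℕ) (X : Fin p → L) (Y : Fin q → L)
    (hXY : ∀ x : L, ∃ P : Fin p → Fin q → L,
      (∀ i j, P i j ∈ 𝓐) ∧ x = ∑ i, ∑ j, X i * P i j * Y j)
    (V : Type*) [AddCommGroup V] [Module ℂ V] [FiniteDimensional ℂ V] [Nontrivial V]
    (ρ : L →ₐ[ℂ] Module.End ℂ V)
    (hirred : ∀ W : Submodule ℂ V, (∀ x : L, ∀ v ∈ W, ρ x v ∈ W) → W = ⊥ ∨ W = ⊤) :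
    (Module.finrank ℂ V : ℝ) ≤
      ((p : ℝ) * (q : ℝ)) ^ (((l : ℝ) + 1) / 2) * ((l : ℝ) + 1) ^ (((l : ℝ) + 1) / 2) := by
  have hsurj := ρ.surjective_of_irreducible hirred
  let B : Subalgebra ℂ (Module.End ℂ V) := Algebra.adjoin ℂ (Set.range fun i => ρ (A i))
  have hAB : ∀ a ∈ 𝓐, ρ a ∈ B := by
    suffices 𝓐 ≤ B.comap ρ from this
    rw [h𝓐gen]
    refine Algebra.adjoin_le (Set.union_subset (fun z hz => ?_) ?_)
    · obtain ⟨μ, hμ⟩ := exists_eq_algebraMap_of_commute ρ hirred (ρ z) fun x => by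
        rw [commute_iff_eq, ← map_mul, ← map_mul,
          Subalgebra.mem_center_iff.mp (h𝓩center hz) x]
      change ρ z ∈ B
      rw [hμ]
      exact B.algebraMap_mem μ
    · rintro _ ⟨i, rfl⟩
      exact Algebra.subset_adjoin ⟨i, rfl⟩
  have hsq : Module.finrank ℂ V ^ 2 ≤ p * q * Module.finrank ℂ B := by
    refine sq_finrank_le_of_forall_eq_sum B (fun i => ρ (X i)) (fun j => ρ (Y j)) fun x => ?_
    obtain ⟨y, rfl⟩ := hsurj x
    obtain ⟨P, hP, rfl⟩ := hXY y
    exact ⟨fun i j => ρ (P i j), fun i j => hAB _ (hP i j), by simp [map_sum]⟩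
  have hcomm (i j : Fin l) : Commute (ρ (A i)) (ρ (A j)) := by
    rw [commute_iff_eq, ← map_mul, ← map_mul, h𝓐comm _ (hA i) _ (hA j)]
  rw [← Real.mul_rpow (by positivity) (by positivity)]
  have := le_rpow_of_sq_le (m := p * q) (Module.finrank_pos (R := ℂ) (M := V))
    fun d => hsq.trans (Nat.mul_le_mul_left _ (finrank_adjoin_range_le_of_commute _ hcomm d))
  rwa [Nat.cast_mul] at this
end
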